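/- Let G and G̃ be independent standard normal random variables and let α, β, γ ∈ ℝ with α² + β² > 0. Then E[ G·( min( exp(αG + βG̃ + γ), 1) ) ] = α·exp(γ + (α² + β²)/2)·Φ( −(γ + α² + β²)/√(α² + β²) ). -/

import Mathlib

open MeasureTheory ProbabilityTheory

noncomputable def Phi (x : ℝ) : ℝ :=
  (Real.sqrt (2 * Real.pi))⁻¹ * ∫ y in Set.Iic x, Real.exp (-y ^ 2 / 2)

open Filter Topology

lemma integrable_exp_neg_sq_div_two : Integrable fun x : ℝ ↦ Real.exp (-x ^ 2 / 2) := by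
  refine (integrable_exp_neg_mul_sq (b := 1 / 2) (by norm_num)).congr (ae_of_all _ fun x ↦ ?_)
  ring_nf

lemma integrable_mul_exp_neg_sq_div_two :
    Integrable fun x : ℝ ↦ x * Real.exp (-x ^ 2 / 2) := by
  refine (integrable_mul_exp_neg_mul_sq (b := 1 / 2) (by norm_num)).congr (ae_of_all _ fun x ↦ ?_)
  ring_nf

lemma hasDerivAt_neg_exp_neg_sq_div_two (x : ℝ) :
    HasDerivAt (fun x : ℝ ↦ -Real.exp (-x ^ 2 / 2)) (x * Real.exp (-x ^ 2 / 2)) x := by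
  have h : HasDerivAt (fun x : ℝ ↦ -x ^ 2 / 2) (-x) x := by
    refine ((hasDerivAt_pow 2 x).neg.div_const 2).congr_deriv ?_
    norm_num
    ring
  exact h.exp.neg.congr_deriv (by ring)

lemma tendsto_neg_exp_neg_sq_div_two {l : Filter ℝ} (hl : Tendsto (fun x : ℝ ↦ x ^ 2) l atTop) :
    Tendsto (fun x : ℝ ↦ -Real.exp (-x ^ 2 / 2)) l (𝓝 0) := by
  rw [← neg_zero]
  refine (Real.tendsto_exp_atBot.comp ?_).neg
  exact (tendsto_neg_atTop_atBot.comp hl).atBot_div_const two_pos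

lemma setIntegral_Iic_mul_exp_neg_sq_div_two (c : ℝ) :
    ∫ x in Set.Iic c, x * Real.exp (-x ^ 2 / 2) = -Real.exp (-c ^ 2 / 2) := by
  rw [integral_Iic_of_hasDerivAt_of_tendsto' (fun x _ ↦ hasDerivAt_neg_exp_neg_sq_div_two x)
    integrable_mul_exp_neg_sq_div_two.integrableOn (tendsto_neg_exp_neg_sq_div_two
      (by simpa [Function.comp_def] using
        (tendsto_pow_atTop (α := ℝ) two_ne_zero).comp tendsto_abs_atBot_atTop)), sub_zero]

lemma setIntegral_Ioi_mul_exp_neg_sq_div_two (c : ℝ) :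
    ∫ x in Set.Ioi c, x * Real.exp (-x ^ 2 / 2) = Real.exp (-c ^ 2 / 2) := by
  rw [integral_Ioi_of_hasDerivAt_of_tendsto' (fun x _ ↦ hasDerivAt_neg_exp_neg_sq_div_two x)
    integrable_mul_exp_neg_sq_div_two.integrableOn (tendsto_neg_exp_neg_sq_div_two
      (tendsto_pow_atTop two_ne_zero)), zero_sub, neg_neg]

lemma setIntegral_Iic_comp_sub_right (g : ℝ → ℝ) (c s : ℝ) :
    ∫ x in Set.Iic c, g (x - s) = ∫ y in Set.Iic (c - s), g y := by
  have := (measurePreserving_sub_right volume s).setIntegral_preimage_emb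
    (measurableEmbedding_subRight s) g (Set.Iic (c - s))
  simpa using this

/-- The truncated exponential tilt of a standard Gaussian: the one-dimensional case. -/
lemma integral_mul_min_exp_gaussianReal {s : ℝ} (hs : 0 < s) (γ : ℝ) :
    ∫ x, x * min (Real.exp (s * x + γ)) 1 ∂(gaussianReal 0 1) =
      s * Real.exp (γ + s ^ 2 / 2) * Phi (-(γ + s ^ 2) / s) := by
  set c : ℝ := -γ / s with hc
  set K : ℝ := Real.exp (γ + s ^ 2 / 2) with hK
  have hcs : c - s = -(γ + s ^ 2) / s := by rw [hc]; field_simp; ring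
  have hsc : s * c = -γ := by rw [hc]; field_simp
  have hKc : K * Real.exp (-(c - s) ^ 2 / 2) = Real.exp (-c ^ 2 / 2) := by
    rw [hK, ← Real.exp_add]
    congr 1
    linear_combination hsc
  have hint : Integrable fun x : ℝ ↦
      x * min (Real.exp (s * x + γ)) 1 * Real.exp (-x ^ 2 / 2) := by
    refine integrable_mul_exp_neg_sq_div_two.mono (by fun_prop) (ae_of_all _ fun x ↦ ?_)
    have h0 : 0 ≤ min (Real.exp (s * x + γ)) 1 := by positivity
    rw [norm_mul, norm_mul, norm_mul, Real.norm_of_nonneg h0]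
    gcongr
    exact mul_le_of_le_one_right (norm_nonneg _) (min_le_right _ _)
  have hIic : ∫ x in Set.Iic c, x * min (Real.exp (s * x + γ)) 1 * Real.exp (-x ^ 2 / 2) =
      K * (-Real.exp (-(c - s) ^ 2 / 2) +
        s * ∫ y in Set.Iic (c - s), Real.exp (-y ^ 2 / 2)) := by
    calc
      _ = ∫ x in Set.Iic c, K * ((x - s) * Real.exp (-(x - s) ^ 2 / 2) +
            s * Real.exp (-(x - s) ^ 2 / 2)) := by
        refine setIntegral_congr_fun measurableSet_Iic fun x hx ↦ ?_
        have hx' : s * x + γ ≤ 0 := by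
          have := mul_le_mul_of_nonneg_left (Set.mem_Iic.1 hx) hs.le
          linarith
        have hexp : Real.exp (s * x + γ) * Real.exp (-x ^ 2 / 2) =
            K * Real.exp (-(x - s) ^ 2 / 2) := by
          rw [hK, ← Real.exp_add, ← Real.exp_add]
          congr 1
          ring
        simp only [min_eq_left (Real.exp_le_one_iff.2 hx')]
        linear_combination x * hexp
      _ = ∫ y in Set.Iic (c - s), K * (y * Real.exp (-y ^ 2 / 2) + s * Real.exp (-y ^ 2 / 2)) :=
        setIntegral_Iic_comp_sub_right
          (fun y ↦ K * (y * Real.exp (-y ^ 2 / 2) + s * Real.exp (-y ^ 2 / 2))) c s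
      _ = _ := by
        rw [integral_const_mul, integral_add integrable_mul_exp_neg_sq_div_two.integrableOn
          (integrable_exp_neg_sq_div_two.const_mul s).integrableOn, integral_const_mul,
          setIntegral_Iic_mul_exp_neg_sq_div_two]
  have hIoi : ∫ x in Set.Ioi c, x * min (Real.exp (s * x + γ)) 1 * Real.exp (-x ^ 2 / 2) =
      Real.exp (-c ^ 2 / 2) := by
    rw [← setIntegral_Ioi_mul_exp_neg_sq_div_two]
    refine setIntegral_congr_fun measurableSet_Ioi fun x hx ↦ ?_
    have hx' : 0 ≤ s * x + γ := by
      have := mul_le_mul_of_nonneg_left (Set.mem_Ioi.1 hx).le hs.le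
      linarith
    simp only [min_eq_right (Real.one_le_exp hx'), mul_one]
  have hdens : ∫ x, x * min (Real.exp (s * x + γ)) 1 ∂(gaussianReal 0 1) =
      (Real.sqrt (2 * Real.pi))⁻¹ *
        ∫ x, x * min (Real.exp (s * x + γ)) 1 * Real.exp (-x ^ 2 / 2) := by
    rw [integral_gaussianReal_eq_integral_smul one_ne_zero, ← integral_const_mul]
    congr with x
    simp [gaussianPDFReal]
    ring
  rw [hdens, ← intervalIntegral.integral_Iic_add_Ioi hint.integrableOn hint.integrableOn (b := c),
    hIic, hIoi, Phi, ← hcs, ← hKc]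
  ring

/-- Rotating a pair of independent standard Gaussians reduces an expectation against a function of
one direction to a one-dimensional integral. -/
lemma integral_mul_comp_gaussian_direction {Ω : Type*} {mΩ : MeasurableSpace Ω} {P : Measure Ω}
    {X Y : Ω → ℝ} (hX : P.map X = gaussianReal 0 1) (hY : P.map Y = gaussianReal 0 1)
    (hXY : IndepFun X Y P) {a b : ℝ} (hab : a ^ 2 + b ^ 2 = 1) {f : ℝ → ℝ} (hf : Measurable f)
    {C : ℝ} (hC : ∀ x, ‖f x‖ ≤ C) :
    ∫ ω, X ω * f (a * X ω + b * Y ω) ∂P = a * ∫ x, x * f x ∂(gaussianReal 0 1) := by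
  have hGX : HasGaussianLaw X P := ⟨by rw [hX]; infer_instance⟩
  have hGY : HasGaussianLaw Y P := ⟨by rw [hY]; infer_instance⟩
  have := hGX.isProbabilityMeasure
  set U : Ω → ℝ := fun ω ↦ a * X ω + b * Y ω with hU
  set V : Ω → ℝ := fun ω ↦ b * X ω - a * Y ω with hV
  have hGUV : HasGaussianLaw (fun ω ↦ (U ω, V ω)) P :=
    (hXY.hasGaussianLaw hGX hGY).map_fun
      ((a • ContinuousLinearMap.fst ℝ ℝ ℝ + b • ContinuousLinearMap.snd ℝ ℝ ℝ).prod
        (b • ContinuousLinearMap.fst ℝ ℝ ℝ - a • ContinuousLinearMap.snd ℝ ℝ ℝ))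
  have hmean {Z : Ω → ℝ} (hZ : P.map Z = gaussianReal 0 1) (hm : AEMeasurable Z P) :
      ∫ ω, Z ω ∂P = 0 := by
    have h := integral_id_gaussianReal (μ := 0) (v := 1)
    rwa [← hZ, integral_map hm (by fun_prop)] at h
  have hvar {Z : Ω → ℝ} (hZ : P.map Z = gaussianReal 0 1) (hm : AEMeasurable Z P) :
      Var[Z; P] = 1 := by
    have h := variance_id_gaussianReal (μ := 0) (v := 1)
    rwa [← hZ, variance_map (by fun_prop) hm] at h
  have haX := hGX.memLp_two.const_mul a
  have hbX := hGX.memLp_two.const_mul b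
  have haY := hGY.memLp_two.const_mul a
  have hbY := hGY.memLp_two.const_mul b
  have hcovXY : cov[X, Y; P] = 0 := hXY.covariance_eq_zero hGX.memLp_two hGY.memLp_two
  have hcov : cov[U, V; P] = 0 := by
    have hcovYX : cov[Y, X; P] = 0 := by rw [covariance_comm, hcovXY]
    change cov[(fun ω ↦ a * X ω) + fun ω ↦ b * Y ω, (fun ω ↦ b * X ω) - fun ω ↦ a * Y ω; P] = 0
    rw [covariance_add_left haX hbY (hbX.sub haY), covariance_sub_right haX hbX haY,
      covariance_sub_right hbY hbX haY]
    simp only [covariance_const_mul_left, covariance_const_mul_right, hcovXY, hcovYX,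
      covariance_self hGX.aemeasurable, covariance_self hGY.aemeasurable,
      hvar hX hGX.aemeasurable, hvar hY hGY.aemeasurable]
    ring
  have hUlaw : P.map U = gaussianReal 0 1 := by
    rw [hGUV.fst.map_eq_gaussianReal]
    congr 1
    · rw [hU, integral_add (hGX.integrable.const_mul a) (hGY.integrable.const_mul b),
        integral_const_mul, integral_const_mul, hmean hX hGX.aemeasurable,
        hmean hY hGY.aemeasurable]
      simp
    · rw [hU, variance_fun_add haX hbY, variance_const_mul, variance_const_mul,
        covariance_const_mul_left, covariance_const_mul_right, hcovXY,
        hvar hX hGX.aemeasurable, hvar hY hGY.aemeasurable]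
      simp [hab]
  have hVmean : ∫ ω, V ω ∂P = 0 := by
    rw [hV, integral_sub (hGX.integrable.const_mul b) (hGY.integrable.const_mul a),
      integral_const_mul, integral_const_mul, hmean hX hGX.aemeasurable,
      hmean hY hGY.aemeasurable]
    simp
  have hindep : IndepFun V (f ∘ U) P :=
    (hGUV.indepFun_of_covariance_eq_zero hcov).symm.comp measurable_id hf
  have hfU : AEStronglyMeasurable (fun ω ↦ f (U ω)) P :=
    (hf.comp_aemeasurable hGUV.fst.aemeasurable).aestronglyMeasurable
  have hVf : ∫ ω, V ω * f (U ω) ∂P = 0 := by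
    have h := hindep.integral_fun_mul_eq_mul_integral
      hGUV.snd.aemeasurable.aestronglyMeasurable hfU
    simpa [hVmean] using h
  have hUf : ∫ ω, U ω * f (U ω) ∂P = ∫ x, x * f x ∂(gaussianReal 0 1) := by
    rw [← hUlaw, integral_map hGUV.fst.aemeasurable (by fun_prop)]
  have hUi := hGUV.fst.integrable.mul_bdd hfU (ae_of_all _ fun ω ↦ hC (U ω))
  have hVi := hGUV.snd.integrable.mul_bdd hfU (ae_of_all _ fun ω ↦ hC (U ω))
  calc
    _ = ∫ ω, a * (U ω * f (U ω)) + b * (V ω * f (U ω)) ∂P := by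
      refine integral_congr_ae (ae_of_all _ fun ω ↦ ?_)
      have hrot : X ω = a * U ω + b * V ω := by
        simp only [hU, hV]
        linear_combination -X ω * hab
      change X ω * f (U ω) = _
      linear_combination f (U ω) * hrot
    _ = _ := by
      rw [integral_add (hUi.const_mul a) (hVi.const_mul b), integral_const_mul,
        integral_const_mul, hVf, hUf]
      ring

theorem stmt_8 {Ω : Type*} [MeasureSpace Ω] [IsProbabilityMeasure (ℙ : Measure Ω)]
    (G Gt : Ω → ℝ)
    (hG : Measure.map G ℙ = gaussianReal 0 1)
    (hGt : Measure.map Gt ℙ = gaussianReal 0 1)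
    (hind : IndepFun G Gt ℙ)
    (α β γ : ℝ) (h : 0 < α ^ 2 + β ^ 2) :
    ∫ ω, G ω * min (Real.exp (α * G ω + β * Gt ω + γ)) 1 ∂ℙ =
      α * Real.exp (γ + (α ^ 2 + β ^ 2) / 2) *
        Phi (-(γ + α ^ 2 + β ^ 2) / Real.sqrt (α ^ 2 + β ^ 2)) := by
  set s : ℝ := Real.sqrt (α ^ 2 + β ^ 2)
  have hs : 0 < s := Real.sqrt_pos.2 h
  have hsq : s ^ 2 = α ^ 2 + β ^ 2 := Real.sq_sqrt h.le
  have hab : (α / s) ^ 2 + (β / s) ^ 2 = 1 := by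
    field_simp
    exact hsq.symm
  have hbound (x : ℝ) : ‖min (Real.exp (s * x + γ)) 1‖ ≤ 1 := by
    rw [Real.norm_of_nonneg (by positivity)]
    exact min_le_right _ _
  have key := integral_mul_comp_gaussian_direction hG hGt hind hab
    (f := fun x ↦ min (Real.exp (s * x + γ)) 1) (by fun_prop) hbound
  rw [integral_mul_min_exp_gaussianReal hs, hsq, ← add_assoc] at key
  have hdir (ω : Ω) : s * (α / s * G ω + β / s * Gt ω) = α * G ω + β * Gt ω := by field_simp
  simp only [hdir] at key
  rw [key]
  field_simp
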